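/- arXiv:2301.07849 — 2 statements merged into one kernel-verified Lean document; each statement's English description precedes it below -/
import Mathlib

section
/- Let m and n be natural numbers. For each t ∈ {1,…,m} let I_t be a finite index set, and let d_{t,i} and c_{t,i} be natural numbers for each i ∈ I_t. Assume: (i) c_{t,i} ≥ 1 for all t and all i ∈ I_t; (ii) for every t ∈ {1,…,m}, ∑_{i ∈ I_t} d_{t,i} ≤ 2n; and (iii) ∑_{t=1}^{m} ∑_{i ∈ I_t} (c_{t,i} − 1) ≤ n. Then ∑_{t=1}^{m} ∑_{i ∈ I_t} c_{t,i} · d_{t,i} ≤ 2n(m + n). -/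
/-- Combinatorial core of the bound on the number of red edges in the first
`O(n)` levels of the virtual history tree. -/
theorem stmt_0 (m n : ℕ) {ι : Type*} (I : ℕ → Finset ι) (d c : ℕ → ι → ℕ)
    (hc : ∀ t ∈ Finset.Icc 1 m, ∀ i ∈ I t, 1 ≤ c t i)
    (hd : ∀ t ∈ Finset.Icc 1 m, ∑ i ∈ I t, d t i ≤ 2 * n)
    (hsum : ∑ t ∈ Finset.Icc 1 m, ∑ i ∈ I t, (c t i - 1) ≤ n) :
    ∑ t ∈ Finset.Icc 1 m, ∑ i ∈ I t, c t i * d t i ≤ 2 * n * (m + n) := by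
  have key : ∀ t ∈ Finset.Icc 1 m, ∑ i ∈ I t, c t i * d t i
      ≤ 2 * n + 2 * n * ∑ i ∈ I t, (c t i - 1) := by
    intro t ht
    calc ∑ i ∈ I t, c t i * d t i
        ≤ ∑ i ∈ I t, (d t i + 2 * n * (c t i - 1)) := by
          refine Finset.sum_le_sum fun i hi => ?_
          have h1 : d t i ≤ 2 * n :=
            (Finset.single_le_sum (f := fun i => d t i)
              (fun _ _ => Nat.zero_le _) hi).trans (hd t ht)
          obtain ⟨k, hk⟩ := Nat.exists_eq_add_of_le (hc t ht i hi)
          rw [hk, Nat.add_sub_cancel_left]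
          nlinarith [Nat.mul_le_mul_right k h1]
      _ = ∑ i ∈ I t, d t i + 2 * n * ∑ i ∈ I t, (c t i - 1) := by
          rw [Finset.sum_add_distrib, Finset.mul_sum]
      _ ≤ _ := Nat.add_le_add_right (hd t ht) _
  calc ∑ t ∈ Finset.Icc 1 m, ∑ i ∈ I t, c t i * d t i
      ≤ ∑ t ∈ Finset.Icc 1 m, (2 * n + 2 * n * ∑ i ∈ I t, (c t i - 1)) :=
        Finset.sum_le_sum key
    _ = m * (2 * n) + 2 * n * ∑ t ∈ Finset.Icc 1 m, ∑ i ∈ I t, (c t i - 1) := by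
        rw [Finset.sum_add_distrib, Finset.sum_const, Finset.mul_sum (Finset.Icc 1 m),
          Nat.card_Icc, Nat.add_sub_cancel, smul_eq_mul]
    _ ≤ m * (2 * n) + 2 * n * n :=
        Nat.add_le_add_left (Nat.mul_le_mul_left _ hsum) _
    _ = 2 * n * (m + n) := by ring
end

section
/- Let V be a finite vertex set with |V| = n ≥ 1, let T ≥ 1 be a natural number, and let (G_t)_{t≥1} be a sequence of simple graphs on V such that for every t ≥ 1 the union graph of G_t, G_{t+1}, …, G_{t+T−1} (in which two vertices are adjacent if they are adjacent in at least one of these graphs) is connected. Fix a vertex p ∈ V, let S_0 = {p}, and define the influence sets by S_t = S_{t−1} ∪ {v ∈ V : v is adjacent in G_t to some u ∈ S_{t−1}} for t ≥ 1. Then S_{T(n−1)} = V. -/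
/-- In a `T`-union-connected dynamic network, information originating at any
process `p` reaches all processes within `T * (n - 1)` rounds. -/
theorem stmt_8 {V : Type*} [Fintype V] (n : ℕ) (hn : Fintype.card V = n) (h1 : 1 ≤ n)
    (T : ℕ) (hT : 1 ≤ T) (G : ℕ → SimpleGraph V)
    (hconn : ∀ t ≥ 1, (⨆ i ∈ Finset.range T, G (t + i)).Connected)
    (p : V) (S : ℕ → Set V) (hS0 : S 0 = {p})
    (hstep : ∀ t, S (t + 1) = S t ∪ {v | ∃ u ∈ S t, (G (t + 1)).Adj u v}) :
    S (T * (n - 1)) = Set.univ := by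
  have hmono : Monotone S := monotone_nat_of_le_succ (fun t => by
    rw [hstep t]; exact Set.subset_union_left)
  have key : ∀ k, S (T * k) = Set.univ ∨ k + 1 ≤ (S (T * k)).ncard := by
    intro k
    induction k with
    | zero => right; simp [hS0]
    | succ k ih =>
      have hle : S (T * k) ⊆ S (T * (k + 1)) := hmono (Nat.mul_le_mul_left _ (Nat.le_succ k))
      by_cases hu : S (T * k) = Set.univ
      · left
        exact Set.eq_univ_of_univ_subset (hu ▸ hle)
      · right
        have hc := ih.resolve_left hu
        obtain ⟨v, hv⟩ := (Set.ne_univ_iff_exists_notMem _).1 hu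
        have hp : p ∈ S (T * k) := hmono (Nat.zero_le _) (by simp [hS0])
        obtain ⟨w⟩ := (hconn (T * k + 1) (by omega)).preconnected p v
        obtain ⟨d, -, hd1, hd2⟩ := w.exists_boundary_dart _ hp hv
        have hadj := d.adj
        simp only [SimpleGraph.iSup_adj, Finset.mem_range] at hadj
        obtain ⟨i, hi, hadj⟩ := hadj
        have h2 : d.snd ∈ S (T * k + i + 1) := by
          rw [hstep]
          refine Or.inr ⟨d.fst, hmono (Nat.le_add_right _ _) hd1, ?_⟩
          rw [show T * k + i + 1 = T * k + 1 + i by omega]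
          exact hadj
        have h3 : d.snd ∈ S (T * (k + 1)) := hmono (by rw [Nat.mul_succ]; omega) h2
        have : (S (T * k)).ncard < (S (T * (k + 1))).ncard :=
          Set.ncard_lt_ncard ⟨hle, fun h => hd2 (h h3)⟩ (Set.toFinite _)
        omega
  rcases key (n - 1) with h | h
  · exact h
  · apply Set.eq_of_subset_of_ncard_le (Set.subset_univ _) _ (Set.toFinite _)
    rw [Set.ncard_univ, Nat.card_eq_fintype_card]
    omega
end
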